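/- (Proposition 1, upper bound.) If m ∈ ℝ is such that ⟨f(X(ω)), f(Y(ω))⟩ ≥ m for μ-almost every ω ∈ Ω, then L_ASM ≤ L_RSM + (1/τ)·(1 − m), i.e. E[ −log( e^{⟨f(X),f(Y)⟩/τ} / ( e^{⟨f(X),f(Y)⟩/τ} + Σ_{i=1}^M e^{⟨f(X), f(Yᵢ⁻)⟩/τ} ) ) ] ≤ −1/τ + E[ log( e^{1/τ} + Σ_{i=1}^M e^{⟨f(X), f(Yᵢ⁻)⟩/τ} ) ] + (1 − m)/τ. -/

import Mathlib

open MeasureTheory RealInnerProductSpace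

theorem neg_log_exp_div_exp_add_nonneg (a : ℝ) {S : ℝ} (hS : 0 ≤ S) :
    0 ≤ -Real.log (Real.exp a / (Real.exp a + S)) := by
  have ha := Real.exp_pos a
  exact neg_nonneg.mpr <| Real.log_nonpos (by positivity)
    ((div_le_one (by positivity)).mpr (by linarith))

theorem neg_log_exp_div_exp_add_le {a b c S : ℝ} (hca : c ≤ a) (hab : a ≤ b) (hS : 0 ≤ S) :
    -Real.log (Real.exp a / (Real.exp a + S)) ≤ Real.log (Real.exp b + S) - c := by
  have ha := Real.exp_pos a
  have hpos : 0 < Real.exp a + S := by positivity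
  rw [Real.log_div ha.ne' hpos.ne', Real.log_exp]
  have hlog : Real.log (Real.exp a + S) ≤ Real.log (Real.exp b + S) := by gcongr
  linarith

/-- The log-sum-exp of finitely many measurable functions bounded above by a constant `b ≥ 0`,
together with `b` itself, is integrable against a finite measure. -/
theorem integrable_log_exp_add_sum_exp {Ω ι : Type*} [MeasurableSpace Ω] [Fintype ι]
    {μ : Measure Ω} [IsFiniteMeasure μ] {b : ℝ} (hb : 0 ≤ b) {g : ι → Ω → ℝ}
    (hg : ∀ i, Measurable (g i)) (hgb : ∀ i ω, g i ω ≤ b) :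
    Integrable (fun ω ↦ Real.log (Real.exp b + ∑ i, Real.exp (g i ω))) μ := by
  have hmeas : Measurable fun ω ↦ Real.log (Real.exp b + ∑ i, Real.exp (g i ω)) := by
    fun_prop
  refine Integrable.of_bound hmeas.aestronglyMeasurable
    (Real.log (Real.exp b + ∑ _i : ι, Real.exp b)) (.of_forall fun ω ↦ ?_)
  have hS : 0 ≤ ∑ i, Real.exp (g i ω) := by positivity
  rw [Real.norm_of_nonneg (Real.log_nonneg (by linarith [Real.one_le_exp hb]))]
  gcongr with i
  exact hgb i ω

/-- Proposition 1, upper bound: if `⟨f(X), f(Y)⟩ ≥ m` almost everywhere, then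
`L_ASM ≤ L_RSM + (1 − m)/τ`. -/
theorem stmt_2 {n d : ℕ} (τ : ℝ) (hτ : 0 < τ) (M : ℕ) (hM : 0 < M)
    {Ω : Type*} [MeasurableSpace Ω] (μ : Measure Ω) [IsProbabilityMeasure μ]
    (f : EuclideanSpace ℝ (Fin n) → EuclideanSpace ℝ (Fin d))
    (hf : Measurable f) (hfnorm : ∀ v, ‖f v‖ = 1)
    (X Y : Ω → EuclideanSpace ℝ (Fin n)) (hX : Measurable X) (hY : Measurable Y)
    (Yneg : Fin M → Ω → EuclideanSpace ℝ (Fin n)) (hYneg : ∀ i, Measurable (Yneg i))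
    (m : ℝ) (hm : ∀ᵐ ω ∂μ, m ≤ ⟪f (X ω), f (Y ω)⟫) :
    ∫ ω, -Real.log (Real.exp (⟪f (X ω), f (Y ω)⟫ / τ) /
        (Real.exp (⟪f (X ω), f (Y ω)⟫ / τ) +
          ∑ i : Fin M, Real.exp (⟪f (X ω), f (Yneg i ω)⟫ / τ))) ∂μ
    ≤ -(1 / τ) +
        (∫ ω, Real.log (Real.exp (1 / τ) +
          ∑ i : Fin M, Real.exp (⟪f (X ω), f (Yneg i ω)⟫ / τ)) ∂μ) +
        (1 - m) / τ := by
  have hint : Integrable (fun ω ↦ Real.log (Real.exp (1 / τ) +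
      ∑ i : Fin M, Real.exp (⟪f (X ω), f (Yneg i ω)⟫ / τ))) μ := by
    refine integrable_log_exp_add_sum_exp (by positivity) (fun i ↦ ?_) (fun i ω ↦ ?_)
    · exact ((hf.comp hX).inner (hf.comp (hYneg i))).div_const τ
    · gcongr
      exact real_inner_le_one_of_norm_eq_one (hfnorm _) (hfnorm _)
  calc
    _ ≤ ∫ ω, (Real.log (Real.exp (1 / τ) +
          ∑ i : Fin M, Real.exp (⟪f (X ω), f (Yneg i ω)⟫ / τ)) - m / τ) ∂μ := by
      refine integral_mono_of_nonneg
        (.of_forall fun ω ↦ neg_log_exp_div_exp_add_nonneg _ (by positivity))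
        (hint.sub (integrable_const _)) ?_
      filter_upwards [hm] with ω hω
      refine neg_log_exp_div_exp_add_le (by gcongr) ?_ (by positivity)
      gcongr
      exact real_inner_le_one_of_norm_eq_one (hfnorm _) (hfnorm _)
    _ = _ := by
      rw [integral_sub hint (integrable_const _), integral_const, probReal_univ, one_smul]
      ring
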